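/- Let p be a prime with p > 3. Every finite simple group of order (p³ − p)/2 is isomorphic to PSL₂(ℤ/p). -/

import Mathlib

open Equiv OnePoint

/-- The permutation `x ↦ a * x + b` of the projective line, fixing `∞`. -/
def affinePerm {K : Type*} [Field K] (a : Kˣ) (b : K) : Perm (OnePoint K) where
  toFun := OnePoint.map fun x => a * x + b
  invFun := OnePoint.map fun x => a⁻¹ * (x - b)
  left_inv x := by cases x <;> simp
  right_inv x := by cases x <;> simp

section affinePerm

variable {K : Type*} [Field K] (a c : Kˣ) (b d x : K)

@[simp]
lemma affinePerm_infty : affinePerm a b ∞ = ∞ := rfl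

@[simp]
lemma affinePerm_coe : affinePerm a b (x : OnePoint K) = ((a * x + b : K) : OnePoint K) := rfl

@[simp]
lemma affinePerm_one_zero : affinePerm (1 : Kˣ) (0 : K) = 1 := by
  ext x; cases x <;> simp

lemma affinePerm_mul : affinePerm a b * affinePerm c d = affinePerm (a * c) (a * d + b) := by
  ext x; cases x <;> simp; ring

lemma affinePerm_inv : (affinePerm a b)⁻¹ = affinePerm a⁻¹ (-(a⁻¹ * b : K)) := by
  rw [inv_eq_iff_mul_eq_one, affinePerm_mul]; simp

lemma affinePerm_eq_one_of_fixed {y : K} (hxy : x ≠ y)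
    (hx : affinePerm a b (x : OnePoint K) = x) (hy : affinePerm a b (y : OnePoint K) = y) :
    affinePerm a b = 1 := by
  rw [affinePerm_coe, coe_eq_coe] at hx hy
  have ha : a = 1 := by
    have h : ((a : K) - 1) * (x - y) = 0 := by linear_combination hx - hy
    exact Units.ext (sub_eq_zero.1 ((mul_eq_zero.1 h).resolve_right (sub_ne_zero.2 hxy)))
  subst ha
  have hb : b = 0 := by simpa using hx
  rw [hb, affinePerm_one_zero]

end affinePerm

/-- The multipliers of the dilations of the projective line belonging to `Γ`. -/
def dilations {K : Type*} [Field K] (Γ : Subgroup (Perm (OnePoint K))) : Subgroup Kˣ where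
  carrier := {a | affinePerm a 0 ∈ Γ}
  one_mem' := by simp [Γ.one_mem]
  mul_mem' {a c} ha hc := by
    have := Γ.mul_mem ha hc
    rwa [affinePerm_mul, mul_zero, zero_add] at this
  inv_mem' {a} ha := by
    have := Γ.inv_mem ha
    rwa [affinePerm_inv, mul_zero, neg_zero] at this

lemma mem_dilations {K : Type*} [Field K] {Γ : Subgroup (Perm (OnePoint K))} {a : Kˣ} :
    a ∈ dilations Γ ↔ affinePerm a 0 ∈ Γ := Iff.rfl

/-- A permutation group of the projective line over `ℤ/p` with the order and the point stabilizers
of `PSL₂(ℤ/p)`, and without nontrivial homomorphisms to `(ℤ/p)ˣ`. -/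
structure IsPSLLike {p : ℕ} [Fact p.Prime] (Γ : Subgroup (Perm (OnePoint (ZMod p)))) : Prop where
  translation_mem (b : ZMod p) : affinePerm 1 b ∈ Γ
  eq_affinePerm {f : Perm (OnePoint (ZMod p))} (hf : f ∈ Γ) (hfi : f ∞ = ∞) :
    ∃ a b, f = affinePerm a b
  mem_dilations_iff (a : (ZMod p)ˣ) : a ∈ dilations Γ ↔ IsSquare (a : ZMod p)
  card_dilations : 2 * Nat.card (dilations Γ) = p - 1
  card_eq : 2 * Nat.card Γ = p * (p + 1) * (p - 1)
  exists_infty_ne : ∃ f ∈ Γ, f ∞ ≠ ∞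
  hom_eq_one (φ : Γ →* (ZMod p)ˣ) : φ = 1

lemma isSquare_div_of_not_isSquare {p : ℕ} [Fact p.Prime] {a b : ZMod p} (ha : ¬ IsSquare a)
    (hb : ¬ IsSquare b) : IsSquare (a / b) := by
  have ha0 : a ≠ 0 := by rintro rfl; simp at ha
  have hb0 : b ≠ 0 := by rintro rfl; simp at hb
  rw [← quadraticChar_neg_one_iff_not_isSquare] at ha hb
  rw [← quadraticChar_one_iff_isSquare (div_ne_zero ha0 hb0)]
  have : a / b * b = a := div_mul_cancel₀ a hb0
  rw [← this, map_mul, hb] at ha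
  linarith

namespace IsPSLLike

variable {p : ℕ} [Fact p.Prime] {Γ : Subgroup (Perm (OnePoint (ZMod p)))}

lemma affinePerm_mem_iff (h : IsPSLLike Γ) {a : (ZMod p)ˣ} {b : ZMod p} :
    affinePerm a b ∈ Γ ↔ IsSquare (a : ZMod p) := by
  rw [← h.mem_dilations_iff, mem_dilations,
    ← Γ.mul_mem_cancel_left (h.translation_mem b) (y := affinePerm a 0), affinePerm_mul]
  simp

lemma exists_affine (h : IsPSLLike Γ) {f : Perm (OnePoint (ZMod p))} (hf : f ∈ Γ)
    (hfi : f ∞ = ∞) : ∃ a b, IsSquare ((a : (ZMod p)ˣ) : ZMod p) ∧ f = affinePerm a b := by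
  obtain ⟨a, b, rfl⟩ := h.eq_affinePerm hf hfi
  exact ⟨a, b, h.affinePerm_mem_iff.1 hf, rfl⟩

lemma exists_map_infty (h : IsPSLLike Γ) (x : OnePoint (ZMod p)) : ∃ f ∈ Γ, f x = ∞ := by
  cases x with
  | infty => exact ⟨1, Γ.one_mem, rfl⟩
  | coe x =>
    obtain ⟨f, hf, hfi⟩ := h.exists_infty_ne
    obtain ⟨y, hy⟩ := OnePoint.ne_infty_iff_exists.1 hfi
    refine ⟨f⁻¹ * affinePerm 1 (y - x), Γ.mul_mem (Γ.inv_mem hf) (h.translation_mem _), ?_⟩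
    simp [hy]

lemma exists_map_infty_zero (h : IsPSLLike Γ) {x y : OnePoint (ZMod p)} (hxy : x ≠ y) :
    ∃ f ∈ Γ, f x = ∞ ∧ f y = ((0 : ZMod p) : OnePoint (ZMod p)) := by
  obtain ⟨f, hf, hfx⟩ := h.exists_map_infty x
  have hfy : f y ≠ ∞ := fun hy => hxy (f.injective (hfx.trans hy.symm))
  obtain ⟨z, hz⟩ := OnePoint.ne_infty_iff_exists.1 hfy
  refine ⟨affinePerm 1 (-z) * f, Γ.mul_mem (h.translation_mem _) hf, ?_, ?_⟩
  · simp [hfx]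
  · simp [← hz]

lemma eq_one_of_fixed (h : IsPSLLike Γ) {f : Perm (OnePoint (ZMod p))} (hf : f ∈ Γ)
    {x y z : OnePoint (ZMod p)} (hxy : x ≠ y) (hxz : x ≠ z) (hyz : y ≠ z) (hx : f x = x)
    (hy : f y = y) (hz : f z = z) : f = 1 := by
  obtain ⟨g, hg, hgx⟩ := h.exists_map_infty x
  have aux {w : OnePoint (ZMod p)} (hw : f w = w) : (g * f * g⁻¹) (g w) = g w := by simp [hw]
  have hgf := aux hx
  rw [hgx] at hgf
  obtain ⟨y', hy'⟩ := OnePoint.ne_infty_iff_exists.1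
    (fun h' => hxy (g.injective (hgx.trans h'.symm)) : g y ≠ ∞)
  obtain ⟨z', hz'⟩ := OnePoint.ne_infty_iff_exists.1
    (fun h' => hxz (g.injective (hgx.trans h'.symm)) : g z ≠ ∞)
  obtain ⟨a, b, hab⟩ := h.eq_affinePerm (Γ.mul_mem (Γ.mul_mem hg hf) (Γ.inv_mem hg)) hgf
  have hyz' : y' ≠ z' := by
    rintro rfl
    exact hyz (g.injective (hy'.symm.trans hz'))
  have := affinePerm_eq_one_of_fixed a b y' hyz' (by rw [← hab, hy', aux hy])
    (by rw [← hab, hz', aux hz])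
  rw [← hab, mul_inv_eq_one, mul_eq_left] at this
  exact this

/-- Among three triples of distinct points, the first two of which are cyclic permutations of each
other, two are conjugate under `Γ`; hence a cyclic permutation of a triple is induced by `Γ`. -/
lemma exists_cycle (h : IsPSLLike Γ) {b : ZMod p} (hb : b ≠ 0) :
    ∃ g ∈ Γ, g ∞ = ((0 : ZMod p) : OnePoint (ZMod p)) ∧ g ((0 : ZMod p) : OnePoint (ZMod p)) = b ∧
      g b = ∞ := by
  have key (x y z : OnePoint (ZMod p)) (hxy : x ≠ y) (hxz : x ≠ z) (hyz : y ≠ z) :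
      ∃ f ∈ Γ, ∃ c : ZMod p, c ≠ 0 ∧ f x = ∞ ∧ f y = ((0 : ZMod p) : OnePoint (ZMod p)) ∧
        f z = c := by
    obtain ⟨f, hf, hx, hy⟩ := h.exists_map_infty_zero hxy
    obtain ⟨c, hc⟩ := OnePoint.ne_infty_iff_exists.1
      (fun h' => hxz (f.injective (hx.trans h'.symm)) : f z ≠ ∞)
    refine ⟨f, hf, c, ?_, hx, hy, hc.symm⟩
    rintro rfl
    exact hyz (f.injective (hy.trans hc))
  have glue {x y z x' y' z' : OnePoint (ZMod p)} {f f' : Perm (OnePoint (ZMod p))} {c c' : ZMod p}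
      (hf : f ∈ Γ) (hf' : f' ∈ Γ) (hc : c ≠ 0) (hc' : c' ≠ 0) (hx : f x = ∞)
      (hy : f y = ((0 : ZMod p) : OnePoint (ZMod p))) (hz : f z = c) (hx' : f' x' = ∞)
      (hy' : f' y' = ((0 : ZMod p) : OnePoint (ZMod p))) (hz' : f' z' = c')
      (hcc : IsSquare (c' / c)) : ∃ g ∈ Γ, g x = x' ∧ g y = y' ∧ g z = z' := by
    refine ⟨f'⁻¹ * affinePerm (Units.mk0 (c' / c) (div_ne_zero hc' hc)) 0 * f,
      Γ.mul_mem (Γ.mul_mem (Γ.inv_mem hf') (h.affinePerm_mem_iff.2 hcc)) hf, ?_, ?_, ?_⟩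
    · simp [hx, Equiv.symm_apply_eq, hx']
    · simp [hy, Equiv.symm_apply_eq, hy']
    · simp [hz, Equiv.symm_apply_eq, hz', hc]
  have h0b : ((0 : ZMod p) : OnePoint (ZMod p)) ≠ (b : OnePoint (ZMod p)) := by
    simpa using hb.symm
  obtain ⟨f₁, hf₁, c₁, hc₁, h11, h12, h13⟩ := key ∞ (0 : ZMod p) b (by simp) (by simp) h0b
  obtain ⟨f₂, hf₂, c₂, hc₂, h21, h22, h23⟩ := key (0 : ZMod p) b ∞ h0b (by simp) (by simp)
  obtain ⟨f₃, hf₃, c₃, hc₃, h31, h32, h33⟩ := key b ∞ (0 : ZMod p) (by simp) h0b.symm (by simp)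
  by_cases h21' : IsSquare (c₂ / c₁)
  · obtain ⟨g, hg, h1, h2, h3⟩ := glue hf₁ hf₂ hc₁ hc₂ h11 h12 h13 h21 h22 h23 h21'
    exact ⟨g, hg, h1, h2, h3⟩
  by_cases h32' : IsSquare (c₃ / c₂)
  · obtain ⟨g, hg, h1, h2, h3⟩ := glue hf₂ hf₃ hc₂ hc₃ h21 h22 h23 h31 h32 h33 h32'
    exact ⟨g, hg, h3, h1, h2⟩
  have h13' : IsSquare (c₁ / c₃) := by
    have := isSquare_div_of_not_isSquare h21' (b := c₂ / c₃)
      (by rwa [← isSquare_inv, inv_div])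
    rwa [div_div_div_cancel_left' _ _ hc₂, ← isSquare_inv, inv_div] at this
  obtain ⟨g, hg, h1, h2, h3⟩ := glue hf₃ hf₁ hc₃ hc₁ h31 h32 h33 h11 h12 h13 h13'
  exact ⟨g, hg, h2, h3, h1⟩

lemma swap_apply (h : IsPSLLike Γ) {t : Perm (OnePoint (ZMod p))} (ht : t ∈ Γ)
    (hti : t ∞ = ((0 : ZMod p) : OnePoint (ZMod p)))
    (ht0 : t ((0 : ZMod p) : OnePoint (ZMod p)) = ∞) {b : ZMod p} (hb : b ≠ 0) :
    ∃ a : (ZMod p)ˣ, IsSquare (a : ZMod p) ∧ t b = ((-(a * b) : ZMod p) : OnePoint (ZMod p)) := by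
  obtain ⟨g, hg, hgi, hg0, hgb⟩ := h.exists_cycle hb
  obtain ⟨a, c, ha, hac⟩ := h.exists_affine (Γ.mul_mem ht hg) (by simp [hgi, ht0])
  have h0 := congr($hac ((0 : ZMod p) : OnePoint (ZMod p)))
  have hb' := congr($hac (b : OnePoint (ZMod p)))
  simp only [Perm.mul_apply, hgb, hti, affinePerm_coe, coe_eq_coe] at hb'
  simp only [Perm.mul_apply, hg0, affinePerm_coe, mul_zero, zero_add] at h0
  exact ⟨a, ha, by rw [h0, coe_eq_coe]; linear_combination -hb'⟩

lemma swap_mul_self_of_isSquare (h : IsPSLLike Γ) (hneg : IsSquare (-1 : ZMod p))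
    {t : Perm (OnePoint (ZMod p))} (ht : t ∈ Γ)
    (hti : t ∞ = ((0 : ZMod p) : OnePoint (ZMod p)))
    (ht0 : t ((0 : ZMod p) : OnePoint (ZMod p)) = ∞) : t * t = 1 := by
  classical
  have hex (x : (ZMod p)ˣ) : ∃ a : dilations Γ,
      t ((x : ZMod p) : OnePoint (ZMod p)) = ((a.1 * x : ZMod p) : OnePoint (ZMod p)) := by
    obtain ⟨a, ha, hax⟩ := h.swap_apply ht hti ht0 x.ne_zero
    refine ⟨⟨-a, (h.mem_dilations_iff _).2 ?_⟩, by simp [hax]⟩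
    simpa using hneg.mul ha
  choose f hf using hex
  by_cases h1 : ∃ x, f x = 1
  · obtain ⟨x, hx⟩ := h1
    have hfx := hf x
    rw [hx] at hfx
    simp only [OneMemClass.coe_one, Units.val_one, one_mul] at hfx
    refine h.eq_one_of_fixed (Γ.mul_mem ht ht) (x := ∞) (y := (0 : ZMod p))
      (z := (x : ZMod p)) (by simp) (by simp) (by simp [eq_comm]) ?_ ?_ ?_ <;>
    simp [hti, ht0, hfx]
  exfalso
  push Not at h1
  have hfib : (Finset.univ : Finset (ZMod p)ˣ).card ≤ 2 * (Finset.univ.image f).card := by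
    refine Finset.card_le_mul_card_image _ _ fun a _ => ?_
    by_contra! hlt
    obtain ⟨x, hx, y, hy, z, hz, hxy, hxz, hyz⟩ := Finset.two_lt_card.1 hlt
    simp only [Finset.mem_filter, Finset.mem_univ, true_and] at hx hy hz
    have aux {w : (ZMod p)ˣ} (hw : f w = a) : (affinePerm a.1⁻¹ 0 * t)
        ((w : ZMod p) : OnePoint (ZMod p)) = ((w : ZMod p) : OnePoint (ZMod p)) := by
      simp [hf, hw, -ZMod.inv_coe_unit]
    have := h.eq_one_of_fixed (Γ.mul_mem (mem_dilations.1 (inv_mem a.2)) ht)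
      (by simpa [Units.ext_iff] using hxy)
      (by simpa [Units.ext_iff] using hxz) (by simpa [Units.ext_iff] using hyz) (aux hx)
      (aux hy) (aux hz)
    simpa [hti, -ZMod.inv_coe_unit] using congr($this ∞)
  have himg : (Finset.univ.image f).card ≤ Fintype.card (dilations Γ) - 1 := by
    rw [← Finset.card_univ, ← Finset.card_erase_of_mem (Finset.mem_univ 1)]
    refine Finset.card_le_card fun a ha => ?_
    obtain ⟨x, -, rfl⟩ := Finset.mem_image.1 ha
    simp [h1 x]
  have hcard := h.card_dilations
  rw [Nat.card_eq_fintype_card] at hcard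
  rw [Finset.card_univ, ZMod.card_units] at hfib
  have := Fintype.card_pos (α := dilations Γ)
  omega

lemma swap_mul_self_of_not_isSquare (h : IsPSLLike Γ) (hneg : ¬ IsSquare (-1 : ZMod p))
    {t : Perm (OnePoint (ZMod p))} (ht : t ∈ Γ)
    (hti : t ∞ = ((0 : ZMod p) : OnePoint (ZMod p)))
    (ht0 : t ((0 : ZMod p) : OnePoint (ZMod p)) = ∞) : t * t = 1 := by
  let D : dilations Γ →* Γ :=
    { toFun a := ⟨affinePerm a 0, a.2⟩
      map_one' := by ext1; simp
      map_mul' a b := by ext1; simp [affinePerm_mul] }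
  have hD : Function.Injective D := by
    intro a b hab
    have := congr(($hab).1 ((1 : ZMod p) : OnePoint (ZMod p)))
    exact Subtype.ext (Units.ext (by simpa [D] using this))
  have hmem {f : Γ} (hi : f.1 ∞ = ∞)
      (h0 : f.1 ((0 : ZMod p) : OnePoint (ZMod p)) = ((0 : ZMod p) : OnePoint (ZMod p))) :
      ∃ a, D a = f := by
    obtain ⟨a, b, -, hab⟩ := h.exists_affine f.2 hi
    rw [hab] at h0
    have hb : b = 0 := by simpa using h0
    subst hb
    exact ⟨⟨a, mem_dilations.2 (hab ▸ f.2)⟩, Subtype.ext hab.symm⟩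
  have hfix {a : dilations Γ} (ha : a ≠ 1) {x : OnePoint (ZMod p)} (hx : (D a).1 x = x) :
      x = ∞ ∨ x = ((0 : ZMod p) : OnePoint (ZMod p)) := by
    cases x with
    | infty => exact .inl rfl
    | coe x =>
      right
      by_contra hx0
      refine ha (Subtype.ext (Units.ext ?_))
      rw [coe_eq_coe] at hx0
      simpa [D, hx0] using hx
  let s : Γ := ⟨t, ht⟩
  obtain ⟨a, ha⟩ : ∃ a, D a = s * s := hmem (by simp [s, hti, ht0]) (by simp [s, hti, ht0])
  have hcomm (k : ℕ) : Commute s (D a ^ k) := by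
    rw [ha]
    exact ((Commute.refl s).mul_right (Commute.refl s)).pow_right k
  have key (k : ℕ) (g : Γ) (hg : g⁻¹ * D a ^ k * g ∈ D.range) : g⁻¹ * D a ^ k * g = D a ^ k := by
    by_cases hak : a ^ k = 1
    · rw [← map_pow, hak]; simp
    suffices hc : Commute g (D a ^ k) by rw [mul_assoc, ← hc.eq, inv_mul_cancel_left]
    obtain ⟨c, hc⟩ := hg
    have hgc : D a ^ k * g = g * D c := by rw [hc]; group
    have aux {x : OnePoint (ZMod p)} (hx : (D c).1 x = x) : (D (a ^ k)).1 (g.1 x) = g.1 x := by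
      have := congr(($hgc).1 x)
      rw [← map_pow] at this
      simpa [hx] using this
    have hDD (b : dilations Γ) : Commute (D b) (D a ^ k) := by
      rw [← map_pow]; exact (Commute.all b _).map D
    have hi := hfix hak (aux (x := ∞) rfl)
    have h0 := hfix hak (aux (x := (0 : ZMod p)) (by simp [D]))
    rcases hi with hi | hi
    · have h0 := h0.resolve_left fun h' => by simpa using g.1.injective (h'.trans hi.symm)
      obtain ⟨b, rfl⟩ := hmem hi h0
      exact hDD b
    · have h0 := h0.resolve_right fun h' => by simpa using g.1.injective (h'.trans hi.symm)
      obtain ⟨b, hb⟩ := hmem (f := s * g) (by simp [s, hi, ht0]) (by simp [s, h0, hti])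
      have : g = s⁻¹ * D b := by rw [hb]; group
      rw [this]
      exact (hcomm k).inv_left.mul_left (hDD b)
  have htrans := MonoidHom.transfer_eq_pow
    ((dilations Γ).subtype.comp (MonoidHom.ofInjective hD).symm.toMonoidHom) (D a) key
  rw [h.hom_eq_one (MonoidHom.transfer _), MonoidHom.one_apply, eq_comm, MonoidHom.comp_apply,
    Subgroup.subtype_apply, OneMemClass.coe_eq_one] at htrans
  have hpow : D a ^ D.range.index = 1 := by
    have := (MonoidHom.ofInjective hD).symm.injective (htrans.trans (map_one _).symm)
    exact congr(($this).1)
  rw [← map_pow] at hpow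
  have hpow := hD (hpow.trans (map_one D).symm)
  have hp2 := (Fact.out : p.Prime).two_le
  have hindex : D.range.index = p * (p + 1) := by
    have h1 := D.range.card_mul_index
    have h2 := Nat.card_congr (MonoidHom.ofInjective hD).toEquiv
    have h3 := h.card_dilations
    have h4 := h.card_eq
    rw [← h1, ← h2, ← mul_assoc, h3, mul_comm] at h4
    exact Nat.eq_of_mul_eq_mul_right (by omega) h4
  rw [hindex] at hpow
  have hfrob : (a : (ZMod p)ˣ) ^ p = a := by
    ext; simp [ZMod.pow_card]
  have hsq : ((a : (ZMod p)ˣ) : ZMod p) * (a : (ZMod p)ˣ) = 1 := by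
    have := congr((($hpow : dilations Γ) : (ZMod p)ˣ))
    rw [SubmonoidClass.coe_pow, pow_mul, hfrob, pow_succ, hfrob] at this
    exact congr(($this).1)
  have ha1 : a = 1 := by
    rcases mul_self_eq_one_iff.1 hsq with h1 | h1
    · exact Subtype.ext (Units.ext h1)
    · exact absurd (h1 ▸ (h.mem_dilations_iff _).1 a.2) hneg
  rw [ha1, map_one] at ha
  exact congr(($ha).1).symm

lemma swap_mul_self (h : IsPSLLike Γ) {t : Perm (OnePoint (ZMod p))} (ht : t ∈ Γ)
    (hti : t ∞ = ((0 : ZMod p) : OnePoint (ZMod p)))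
    (ht0 : t ((0 : ZMod p) : OnePoint (ZMod p)) = ∞) : t * t = 1 := by
  by_cases hneg : IsSquare (-1 : ZMod p)
  · exact h.swap_mul_self_of_isSquare hneg ht hti ht0
  · exact h.swap_mul_self_of_not_isSquare hneg ht hti ht0

lemma swap_mul_apply (h : IsPSLLike Γ) {t : Perm (OnePoint (ZMod p))} (ht : t ∈ Γ)
    (hti : t ∞ = ((0 : ZMod p) : OnePoint (ZMod p)))
    (ht0 : t ((0 : ZMod p) : OnePoint (ZMod p)) = ∞) {a x y : ZMod p} (ha : IsSquare a)
    (ha0 : a ≠ 0) (hxy : t x = y) :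
    t ((a * x : ZMod p) : OnePoint (ZMod p)) = ((a⁻¹ * y : ZMod p) : OnePoint (ZMod p)) := by
  let d := affinePerm (Units.mk0 a ha0) 0
  have hd : d ∈ Γ := h.affinePerm_mem_iff.2 ha
  have h2 := h.swap_mul_self (Γ.mul_mem ht hd) (by simp [d, hti]) (by simp [d, ht0])
  have h1 := h.swap_mul_self ht hti ht0
  have h3 : t * d = d⁻¹ * t := by
    have : d * (t * d) = t := by
      calc d * (t * d) = t * t * d * (t * d) := by rw [h1, one_mul]
        _ = t * (t * d * (t * d)) := by group
        _ = t := by rw [h2, mul_one]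
    rw [eq_inv_mul_iff_mul_eq, this]
  have h4 := congr($h3 (x : OnePoint (ZMod p)))
  simpa [d, hxy, affinePerm_inv] using h4

lemma exists_normalized_swap (h : IsPSLLike Γ) : ∃ t ∈ Γ,
    t ∞ = ((0 : ZMod p) : OnePoint (ZMod p)) ∧ t ((0 : ZMod p) : OnePoint (ZMod p)) = ∞ ∧
      t ((1 : ZMod p) : OnePoint (ZMod p)) = ((-1 : ZMod p) : OnePoint (ZMod p)) := by
  obtain ⟨t, ht, ht0, hti⟩ := h.exists_map_infty_zero
    (x := ((0 : ZMod p) : OnePoint (ZMod p))) (y := ∞) (by simp)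
  obtain ⟨a, ha, hta⟩ := h.swap_apply ht hti ht0 one_ne_zero
  refine ⟨affinePerm a⁻¹ 0 * t, Γ.mul_mem (h.affinePerm_mem_iff.2 (by
    simpa [-ZMod.inv_coe_unit] using ha)) ht, ?_, ?_, ?_⟩ <;>
  simp [hti, ht0, hta, -ZMod.inv_coe_unit]

lemma exists_not_isSquare_and_isSquare_add_one (hp : p ≠ 2) :
    ∃ w : ZMod p, ¬ IsSquare w ∧ IsSquare (w + 1) := by
  by_contra! hcon
  obtain ⟨n, hn⟩ := FiniteField.exists_nonsquare (F := ZMod p) (by rwa [ZMod.ringChar_zmod_n])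
  have hall (k : ℕ) : ¬ IsSquare (n + k) := by
    induction k with
    | zero => simpa using hn
    | succ k ih => simpa [add_assoc] using hcon _ ih
  exact hall (-n).val (by simp)

lemma exists_inversion (h : IsPSLLike Γ) (hp : p ≠ 2) : ∃ t ∈ Γ,
    t ∞ = ((0 : ZMod p) : OnePoint (ZMod p)) ∧ t ((0 : ZMod p) : OnePoint (ZMod p)) = ∞ ∧
      ∀ x : ZMod p, x ≠ 0 → t (x : OnePoint (ZMod p)) = ((-x⁻¹ : ZMod p) : OnePoint (ZMod p)) := by
  obtain ⟨t, ht, hti, ht0, ht1⟩ := h.exists_normalized_swap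
  refine ⟨t, ht, hti, ht0, ?_⟩
  have htt (x : OnePoint (ZMod p)) : t (t x) = x := congr($(h.swap_mul_self ht hti ht0) x)
  have htn1 : t ((-1 : ZMod p) : OnePoint (ZMod p)) = ((1 : ZMod p) : OnePoint (ZMod p)) := by
    rw [← ht1, htt]
  have hsq {x : ZMod p} (hx : IsSquare x) (hx0 : x ≠ 0) :
      t (x : OnePoint (ZMod p)) = ((-x⁻¹ : ZMod p) : OnePoint (ZMod p)) := by
    simpa using h.swap_mul_apply ht hti ht0 hx hx0 ht1
  -- It is enough to treat one nonsquare.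
  suffices hns : ∃ w : ZMod p, ¬ IsSquare w ∧
      t (w : OnePoint (ZMod p)) = ((-w⁻¹ : ZMod p) : OnePoint (ZMod p)) by
    obtain ⟨w, hw, htw⟩ := hns
    intro x hx0
    by_cases hx : IsSquare x
    · exact hsq hx hx0
    have hw0 : w ≠ 0 := by rintro rfl; simp at hw
    have := h.swap_mul_apply ht hti ht0 (isSquare_div_of_not_isSquare hx hw)
      (div_ne_zero hx0 hw0) htw
    rw [div_mul_cancel₀ _ hw0] at this
    rw [this, coe_eq_coe]
    field_simp
  by_cases hneg : IsSquare (-1 : ZMod p)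
  swap
  · exact ⟨-1, hneg, by rw [htn1]; simp⟩
  obtain ⟨w, hw, hw1⟩ := exists_not_isSquare_and_isSquare_add_one hp
  refine ⟨w, hw, ?_⟩
  have hw0 : w ≠ 0 := by rintro rfl; simp at hw
  have hw10 : w + 1 ≠ 0 := fun h0 => hw (by rwa [eq_neg_of_add_eq_zero_left h0])
  obtain ⟨a, ha, htw⟩ := h.swap_apply ht hti ht0 hw0
  -- `k` measures the deviation of `t` from `x ↦ -x⁻¹` on nonsquares.
  set k : ZMod p := a * w ^ 2 with hk
  have hk_sq : IsSquare k := ha.mul (IsSquare.sq w)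
  have hk0 : k ≠ 0 := by simp [hk, hw0]
  have htw' : t (w : OnePoint (ZMod p)) = ((-(k / w) : ZMod p) : OnePoint (ZMod p)) := by
    rw [htw, coe_eq_coe, hk]; field_simp
  have hkw : k + w ≠ 0 := fun h0 => hw (by
    rw [eq_neg_of_add_eq_zero_right h0, neg_eq_neg_one_mul]; exact hneg.mul hk_sq)
  let g := t * affinePerm 1 (-1)
  have hg : g ∈ Γ := Γ.mul_mem ht (h.translation_mem _)
  have hg3 : g * g * g = 1 := by
    refine h.eq_one_of_fixed (Γ.mul_mem (Γ.mul_mem hg hg) hg) (x := ∞) (y := (0 : ZMod p))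
      (z := (1 : ZMod p)) (by simp) (by simp) (by simp) ?_ ?_ ?_ <;>
    simp [g, hti, ht0, htn1]
  have hrel : t ((-(k / w) - 1 : ZMod p) : OnePoint (ZMod p)) =
      ((w / (w + 1) : ZMod p) : OnePoint (ZMod p)) := by
    have h3 := congr($hg3 ((w + 1 : ZMod p) : OnePoint (ZMod p)))
    have h4 : (affinePerm 1 (-1) * t * affinePerm 1 (-1) : Perm (OnePoint (ZMod p)))
        ((-(k / w) : ZMod p) : OnePoint (ZMod p))
        = t ((w + 1 : ZMod p) : OnePoint (ZMod p)) := by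
      apply t.injective
      rw [htt]
      simpa [g, htw'] using h3
    rw [hsq hw1 hw10] at h4
    have h5 := congr(affinePerm 1 1 $h4)
    rw [← Perm.mul_apply, ← mul_assoc, ← mul_assoc, affinePerm_mul] at h5
    simp only [mul_one, Units.val_one, neg_add_cancel, affinePerm_one_zero, one_mul,
      Perm.mul_apply, affinePerm_coe] at h5
    rw [sub_eq_add_neg, h5, coe_eq_coe]
    field_simp
    ring
  have hrel' : t ((w / (w + 1) : ZMod p) : OnePoint (ZMod p)) =
      ((-(k / w) - 1 : ZMod p) : OnePoint (ZMod p)) := by rw [← hrel, htt]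
  rw [div_eq_inv_mul, h.swap_mul_apply ht hti ht0 (isSquare_inv.2 hw1) (inv_ne_zero hw10) htw',
    coe_eq_coe] at hrel'
  have hk1 : k = 1 := by
    field_simp at hrel'
    have : w * (k - 1) = 0 := by linear_combination -hrel'
    exact sub_eq_zero.1 ((mul_eq_zero.1 this).resolve_left hw0)
  rw [htw', hk1, one_div]

end IsPSLLike

lemma Matrix.SpecialLinearGroup.apply_zero_zero_mul_apply_one_one {K : Type*} [Field K]
    (A : Matrix.SpecialLinearGroup (Fin 2) K) (hA : A 1 0 = 0) : A 0 0 * A 1 1 = 1 := by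
  have := A.det_coe
  rwa [Matrix.det_fin_two, hA, mul_zero, sub_zero] at this

open Matrix in
/-- The action of `SL₂` on the projective line by Möbius transformations. -/
noncomputable def specialLinearPermHom (K : Type*) [Field K] [DecidableEq K] :
    SpecialLinearGroup (Fin 2) K →* Perm (OnePoint K) :=
  (MulAction.toPermHom (GL (Fin 2) K) (OnePoint K)).comp SpecialLinearGroup.toGL

section specialLinearPermHom

open Matrix

variable {K : Type*} [Field K] [DecidableEq K]

lemma specialLinearPermHom_infty (A : SpecialLinearGroup (Fin 2) K) :
    specialLinearPermHom K A ∞ = if A 1 0 = 0 then ∞ else ((A 0 0 / A 1 0 : K) : OnePoint K) :=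
  smul_infty_eq_ite _

lemma specialLinearPermHom_coe (A : SpecialLinearGroup (Fin 2) K) (x : K) :
    specialLinearPermHom K A (x : OnePoint K) = if A 1 0 * x + A 1 1 = 0 then ∞ else
      (((A 0 0 * x + A 0 1) / (A 1 0 * x + A 1 1) : K) : OnePoint K) :=
  smul_some_eq_ite

lemma specialLinearPermHom_eq_affinePerm {A : SpecialLinearGroup (Fin 2) K} (hA : A 1 0 = 0) :
    ∃ a : Kˣ, (a : K) = A 0 0 ∧ specialLinearPermHom K A = affinePerm (a ^ 2) (a * A 0 1) := by
  have hdet := A.apply_zero_zero_mul_apply_one_one hA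
  have h0 : A 0 0 ≠ 0 := left_ne_zero_of_mul_eq_one hdet
  have h1 : A 1 1 = (A 0 0)⁻¹ := eq_inv_of_mul_eq_one_right hdet
  refine ⟨Units.mk0 _ h0, rfl, ?_⟩
  ext x
  cases x with
  | infty => simp [specialLinearPermHom_infty, hA]
  | coe x =>
    rw [specialLinearPermHom_coe, affinePerm_coe, hA, h1, zero_mul, zero_add,
      if_neg (inv_ne_zero h0), coe_eq_coe]
    simp
    ring

lemma affinePerm_mem_range_specialLinearPermHom {a : Kˣ} (ha : IsSquare (a : K)) (b : K) :
    affinePerm a b ∈ (specialLinearPermHom K).range := by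
  obtain ⟨c, hc⟩ := ha
  have hc0 : c ≠ 0 := by rintro rfl; simp at hc
  obtain ⟨A, hA⟩ : ∃ A : SpecialLinearGroup (Fin 2) K, A.1 = !![c, b / c; 0, c⁻¹] :=
    ⟨⟨_, by simp [det_fin_two, hc0]⟩, rfl⟩
  obtain ⟨d, hd, hAd⟩ := specialLinearPermHom_eq_affinePerm (A := A) (by simp [hA])
  replace hd : (d : K) = c := by simpa [hA] using hd
  refine ⟨A, ?_⟩
  rw [hAd]
  congr 1
  · ext; rw [hc, Units.val_pow_eq_pow_val, hd, sq]
  · simp [hA, hd, mul_div_cancel₀, hc0]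

lemma mem_range_specialLinearPermHom_of_inversion {t : Perm (OnePoint K)}
    (hti : t ∞ = ((0 : K) : OnePoint K)) (ht0 : t ((0 : K) : OnePoint K) = ∞)
    (ht : ∀ x : K, x ≠ 0 → t (x : OnePoint K) = ((-x⁻¹ : K) : OnePoint K)) :
    t ∈ (specialLinearPermHom K).range := by
  obtain ⟨A, hA⟩ : ∃ A : SpecialLinearGroup (Fin 2) K, A.1 = !![0, -1; 1, 0] :=
    ⟨⟨_, by simp [det_fin_two]⟩, rfl⟩
  refine ⟨A, ?_⟩
  ext x
  cases x with
  | infty => simp [specialLinearPermHom_infty, hA, hti]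
  | coe x =>
    rw [specialLinearPermHom_coe]
    by_cases hx : x = 0
    · simp [hx, hA, ht0]
    · simp [hx, hA, ht, neg_div]

lemma ker_specialLinearPermHom :
    (specialLinearPermHom K).ker = Subgroup.center (SpecialLinearGroup (Fin 2) K) := by
  ext A
  rw [MonoidHom.mem_ker, Matrix.SpecialLinearGroup.mem_center_iff]
  constructor
  · intro h
    have hA : A 1 0 = 0 := by
      have := congr($h ∞)
      rw [specialLinearPermHom_infty] at this
      by_contra hne
      simp [hne] at this
    obtain ⟨a, ha, hA'⟩ := specialLinearPermHom_eq_affinePerm hA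
    have hdet := A.apply_zero_zero_mul_apply_one_one hA
    rw [h] at hA'
    have h0 : A 0 1 = 0 := by
      have := congr($hA' ((0 : K) : OnePoint K))
      simpa using this
    have h1 : A 0 0 ^ 2 = 1 := by
      have := congr($hA' ((1 : K) : OnePoint K))
      simpa [h0, ha, eq_comm] using this
    have h2 : A 1 1 = A 0 0 := by linear_combination A 0 0 * hdet - A 1 1 * h1
    refine ⟨A 0 0, by simpa using h1, ?_⟩
    ext i j
    fin_cases i <;> fin_cases j <;> simp [hA, h0, h2]
  · rintro ⟨r, hr, hA⟩
    have hr0 : r ≠ 0 := by rintro rfl; simp at hr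
    have hA' (i j : Fin 2) : A i j = scalar (Fin 2) r i j := by rw [hA]
    ext x
    cases x with
    | infty => simp [specialLinearPermHom_infty, hA']
    | coe x => simp [specialLinearPermHom_coe, hA', hr0]

end specialLinearPermHom

lemma Subgroup.le_of_stabilizer_infty_le {K : Type*} [Field K] {Γ Δ : Subgroup (Perm (OnePoint K))}
    (hΓ : ∀ b : K, affinePerm 1 b ∈ Γ) (hΔ : ∀ b : K, affinePerm 1 b ∈ Δ)
    {t : Perm (OnePoint K)} (htΓ : t ∈ Γ) (htΔ : t ∈ Δ) (ht : t ((0 : K) : OnePoint K) = ∞)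
    (hle : ∀ f ∈ Γ, f ∞ = ∞ → f ∈ Δ) : Γ ≤ Δ := by
  intro f hf
  by_cases hfi : f ∞ = ∞
  · exact hle f hf hfi
  obtain ⟨y, hy⟩ := OnePoint.ne_infty_iff_exists.1 hfi
  rw [← Δ.mul_mem_cancel_left (Δ.mul_mem htΔ (hΔ (-y)))]
  exact hle _ (Γ.mul_mem (Γ.mul_mem htΓ (hΓ _)) hf) (by simp [← hy, ht])

lemma IsPSLLike.eq_range {p : ℕ} [Fact p.Prime] {Γ : Subgroup (Perm (OnePoint (ZMod p)))}
    (h : IsPSLLike Γ) (hp : p ≠ 2) : Γ = (specialLinearPermHom (ZMod p)).range := by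
  obtain ⟨t, ht, hti, ht0, htx⟩ := h.exists_inversion hp
  have ht' := mem_range_specialLinearPermHom_of_inversion hti ht0 htx
  have htrans (b : ZMod p) : affinePerm 1 b ∈ (specialLinearPermHom (ZMod p)).range :=
    affinePerm_mem_range_specialLinearPermHom (by simp) b
  refine le_antisymm (Subgroup.le_of_stabilizer_infty_le h.translation_mem htrans ht ht' ht0 ?_)
    (Subgroup.le_of_stabilizer_infty_le htrans h.translation_mem ht' ht ht0 ?_)
  · intro f hf hfi
    obtain ⟨a, b, ha, rfl⟩ := h.exists_affine hf hfi
    exact affinePerm_mem_range_specialLinearPermHom ha b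
  · rintro - ⟨A, rfl⟩ hfi
    have hA : A 1 0 = 0 := by
      rw [specialLinearPermHom_infty] at hfi
      by_contra hne
      simp [hne] at hfi
    obtain ⟨a, -, hA'⟩ := specialLinearPermHom_eq_affinePerm hA
    rw [hA', h.affinePerm_mem_iff, Units.val_pow_eq_pow_val]
    exact IsSquare.sq _

section affineStabilizer

variable {p : ℕ} [Fact p.Prime] {Γ : Subgroup (Perm (OnePoint (ZMod p)))}

lemma exists_eq_affinePerm_of_mul_translation {f : Perm (OnePoint (ZMod p))} (hfi : f ∞ = ∞)
    {c : ZMod p} (hf : f * affinePerm 1 1 = affinePerm 1 c * f) : ∃ a b, f = affinePerm a b := by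
  obtain ⟨b, hb⟩ := OnePoint.ne_infty_iff_exists.1
    (fun h' => by simpa using f.injective (h'.trans hfi.symm) :
      f ((0 : ZMod p) : OnePoint (ZMod p)) ≠ ∞)
  have hnat (k : ℕ) : f ((k : ZMod p) : OnePoint (ZMod p)) =
      ((c * k + b : ZMod p) : OnePoint (ZMod p)) := by
    induction k with
    | zero => simp [hb]
    | succ k ih =>
      have := congr($hf ((k : ZMod p) : OnePoint (ZMod p)))
      simp only [Perm.mul_apply, affinePerm_coe, Units.val_one, one_mul, ih] at this
      rw [Nat.cast_succ, this, coe_eq_coe]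
      ring
  have hall (x : ZMod p) : f (x : OnePoint (ZMod p)) =
      ((c * x + b : ZMod p) : OnePoint (ZMod p)) := by
    simpa using hnat x.val
  have hc : c ≠ 0 := by
    rintro rfl
    have := f.injective ((hall 0).trans (by simp [hall 1] : _ = f ((1 : ZMod p) : OnePoint _)))
    simp at this
  refine ⟨Units.mk0 c hc, b, ?_⟩
  ext x
  cases x with
  | infty => simp [hfi]
  | coe x => simp [hall]

lemma card_stabilizer_infty (htrans : ∀ b : ZMod p, affinePerm 1 b ∈ Γ)
    (haff : ∀ f ∈ Γ, f ∞ = ∞ → ∃ a b, f = affinePerm a b) :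
    Nat.card (MulAction.stabilizer Γ (∞ : OnePoint (ZMod p))) = Nat.card (dilations Γ) * p := by
  have hmem (a : dilations Γ) (b : ZMod p) : affinePerm a.1 b ∈ Γ := by
    have := Γ.mul_mem (htrans b) (mem_dilations.1 a.2)
    rwa [affinePerm_mul, one_mul, mul_zero, zero_add] at this
  let F : dilations Γ × ZMod p → MulAction.stabilizer Γ (∞ : OnePoint (ZMod p)) :=
    fun x => ⟨⟨affinePerm x.1 x.2, hmem x.1 x.2⟩, rfl⟩
  have hF : Function.Bijective F := by
    constructor
    · rintro ⟨a, b⟩ ⟨c, d⟩ hac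
      replace hac : affinePerm a.1 b = affinePerm c.1 d := congr(($hac).1.1)
      have h0 : b = d := by simpa using congr($hac ((0 : ZMod p) : OnePoint (ZMod p)))
      have h1 : (a.1 : ZMod p) = c.1 := by
        simpa [h0] using congr($hac ((1 : ZMod p) : OnePoint (ZMod p)))
      rw [Prod.mk.injEq]
      exact ⟨Subtype.ext (Units.ext h1), h0⟩
    · rintro ⟨⟨f, hf⟩, hfi⟩
      replace hfi : f ∞ = ∞ := hfi
      obtain ⟨a, b, rfl⟩ := haff f hf hfi
      have ha : a ∈ dilations Γ := by
        have := Γ.mul_mem (htrans (-b)) hf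
        rw [affinePerm_mul] at this
        rw [mem_dilations]
        simpa using this
      exact ⟨(⟨a, ha⟩, b), rfl⟩
  rw [← Nat.card_congr (Equiv.ofBijective F hF), Nat.card_prod, Nat.card_zmod]

lemma isPretransitive_of_translation_mem (htrans : ∀ b : ZMod p, affinePerm 1 b ∈ Γ)
    (hne : ∃ f ∈ Γ, f ∞ ≠ ∞) : MulAction.IsPretransitive Γ (OnePoint (ZMod p)) := by
  obtain ⟨f, hf, hfi⟩ := hne
  obtain ⟨y, hy⟩ := OnePoint.ne_infty_iff_exists.1 hfi
  rw [MulAction.isPretransitive_iff_base (∞ : OnePoint (ZMod p))]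
  intro x
  cases x with
  | infty => exact ⟨1, one_smul _ _⟩
  | coe x =>
    refine ⟨⟨affinePerm 1 (x - y) * f, Γ.mul_mem (htrans _) hf⟩, ?_⟩
    rw [Subgroup.mk_smul, Perm.smul_def]
    simp [← hy]

lemma isPSLLike_of_isSimpleGroup (hp : p ≠ 2) (hsimple : IsSimpleGroup Γ)
    (htrans : ∀ b : ZMod p, affinePerm 1 b ∈ Γ)
    (haff : ∀ f ∈ Γ, f ∞ = ∞ → ∃ a b, f = affinePerm a b)
    (hcard : 2 * Nat.card Γ = p * (p + 1) * (p - 1)) (hne : ∃ f ∈ Γ, f ∞ ≠ ∞) :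
    IsPSLLike Γ := by
  have hpp : p.Prime := Fact.out
  have hp2 := hpp.two_le
  have hodd := hpp.eq_two_or_odd.resolve_left hp
  have hdil : 2 * Nat.card (dilations Γ) = p - 1 := by
    have := isPretransitive_of_translation_mem htrans hne
    have h1 := (MulAction.stabilizer Γ (∞ : OnePoint (ZMod p))).card_mul_index
    rw [MulAction.index_stabilizer_of_transitive, card_stabilizer_infty htrans haff] at h1
    have h2 : Nat.card (OnePoint (ZMod p)) = p + 1 := by
      rw [show Nat.card (OnePoint (ZMod p)) = Nat.card (Option (ZMod p)) from rfl,
        Finite.card_option, Nat.card_zmod]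
    rw [← h1, h2] at hcard
    refine Nat.eq_of_mul_eq_mul_left (show 0 < p * (p + 1) by positivity) ?_
    rw [← hcard]
    ring
  refine ⟨htrans, haff _, fun a => ⟨fun ha => ?_, fun ha => ?_⟩, hdil, hcard, hne, fun φ => ?_⟩
  · rw [ZMod.euler_criterion p a.ne_zero]
    have h1 : (⟨a, ha⟩ : dilations Γ) ^ Nat.card (dilations Γ) = 1 := pow_card_eq_one'
    rw [show Nat.card (dilations Γ) = p / 2 by omega] at h1
    exact congr((($h1).1 : ZMod p))
  · obtain ⟨b, hb⟩ := ha
    have hb0 : b ≠ 0 := by rintro rfl; simp at hb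
    have hindex : (dilations Γ).index = 2 := by
      have h1 := (dilations Γ).card_mul_index
      rw [Nat.card_eq_fintype_card (α := (ZMod p)ˣ), ZMod.card_units, ← hdil, mul_comm] at h1
      exact Nat.eq_of_mul_eq_mul_right Nat.card_pos h1
    have := Subgroup.sq_mem_of_index_two hindex (Units.mk0 b hb0)
    convert this using 1
    ext
    simp [hb, sq]
  · rcases hsimple.eq_bot_or_eq_top_of_normal φ.ker inferInstance with hk | hk
    · have hle := Nat.card_le_card_of_injective φ ((MonoidHom.ker_eq_bot_iff φ).1 hk)
      rw [Nat.card_eq_fintype_card (α := (ZMod p)ˣ), ZMod.card_units] at hle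
      have : 2 * 3 ≤ p * (p + 1) := Nat.mul_le_mul hp2 (by omega)
      have := Nat.mul_le_mul_right (p - 1) this
      omega
    · ext1 x
      exact MonoidHom.mem_ker.1 (hk ▸ Subgroup.mem_top x)

end affineStabilizer

lemma eq_add_one_of_modEq_of_dvd {p n m : ℕ} (hp : 1 < p) (hn : n ≡ 1 [MOD p]) (hn1 : n ≠ 1)
    (hm : 2 * (n * m) = (p + 1) * (p - 1)) : n = p + 1 := by
  have hn0 : n ≠ 0 := by
    rintro rfl
    have : 0 < (p + 1) * (p - 1) := Nat.mul_pos (by omega) (by omega)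
    omega
  obtain ⟨k, hk⟩ := (Nat.modEq_iff_dvd' (by omega)).1 hn.symm
  have hnk : n = p * k + 1 := by omega
  subst hnk
  have hk1 : 1 ≤ k := by
    rcases Nat.eq_zero_or_pos k with rfl | hk0
    · simp at hn1
    · exact hk0
  have hm' : 2 * ((p * k + 1) * m : ℤ) = (p + 1) * (p - 1) := by
    have := congr((($hm : ℕ) : ℤ))
    push_cast [Nat.cast_sub hp.le] at this
    exact this
  obtain ⟨j, hj⟩ : (p : ℤ) ∣ 2 * m + 1 := ⟨p - 2 * k * m, by linear_combination hm'⟩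
  have hp0 : (0 : ℤ) < p := by omega
  have hj1 : 1 ≤ j := by
    by_contra! hlt
    nlinarith [mul_nonneg hp0.le (show (0 : ℤ) ≤ -j by omega)]
  have hkj : (j : ℤ) + k * j * p - k = p := by
    refine mul_left_cancel₀ hp0.ne' ?_
    linear_combination hm' - (p * k + 1 : ℤ) * hj
  have hkz : (1 : ℤ) ≤ k := by exact_mod_cast hk1
  have hpz : (2 : ℤ) ≤ p := by omega
  have hj' : j = 1 := by
    by_contra hne
    nlinarith [mul_nonneg (mul_nonneg (show (0 : ℤ) ≤ k by omega) hp0.le)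
      (show (0 : ℤ) ≤ j - 2 by omega), mul_nonneg (show (0 : ℤ) ≤ k - 1 by omega) hp0.le]
  subst hj'
  have hk' : ((k : ℤ) - 1) * (p - 1) = 0 := by linear_combination hkj
  have : (k : ℤ) = 1 := by
    rcases mul_eq_zero.1 hk' with h | h <;> omega
  have : k = 1 := by exact_mod_cast this
  rw [this, mul_one]

section sylow

variable {p : ℕ} [Fact p.Prime] {G : Type*} [Group G] [Finite G]

lemma card_sylow_eq_prime (hcard : 2 * Nat.card G = p * (p + 1) * (p - 1)) (hp : p ≠ 2)
    (P : Sylow p G) : Nat.card P = p := by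
  have hpp : p.Prime := Fact.out
  have hdvd : p ∣ Nat.card G := by
    refine (Nat.Coprime.dvd_mul_left ((Nat.coprime_primes hpp Nat.prime_two).2 hp)).1 ?_
    rw [hcard, mul_assoc]
    exact dvd_mul_right _ _
  have h1 := P.dvd_card_of_dvd_card hdvd
  obtain ⟨k, hk⟩ := IsPGroup.iff_card.1 P.isPGroup'
  rw [hk] at h1 ⊢
  have hk0 : k ≠ 0 := by
    rintro rfl
    exact hpp.one_lt.ne' (Nat.dvd_one.1 (by simpa using h1))
  have hk2 : k < 2 := by
    by_contra! hk2
    have h2 : p ^ 2 ∣ Nat.card G :=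
      ((pow_dvd_pow p hk2).trans (dvd_of_eq hk.symm)).trans (P : Subgroup G).card_subgroup_dvd_card
    have h3 : p * p ∣ p * ((p + 1) * (p - 1)) := by
      rw [← mul_assoc, ← hcard, ← sq]; exact h2.mul_left 2
    rcases hpp.dvd_mul.1 (Nat.dvd_of_mul_dvd_mul_left hpp.pos h3) with h4 | h4
    · exact hpp.one_lt.ne' (Nat.dvd_one.1 ((Nat.dvd_add_right dvd_rfl).1 h4))
    · have := Nat.le_of_dvd (Nat.sub_pos_of_lt hpp.one_lt) h4
      have := hpp.two_le
      omega
  rw [show k = 1 by omega, pow_one]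

lemma card_sylow_eq_add_one (hsimple : IsSimpleGroup G)
    (hcard : 2 * Nat.card G = p * (p + 1) * (p - 1)) (hp : p ≠ 2) :
    Nat.card (Sylow p G) = p + 1 := by
  have hpp : p.Prime := Fact.out
  obtain ⟨P⟩ : Nonempty (Sylow p G) := inferInstance
  have hP := card_sylow_eq_prime hcard hp P
  obtain ⟨m, hm⟩ := P.card_dvd_index
  have hindex : 2 * (P : Subgroup G).index = (p + 1) * (p - 1) := by
    refine Nat.eq_of_mul_eq_mul_left hpp.pos ?_
    rw [← mul_assoc p (p + 1), ← hcard, ← (P : Subgroup G).card_mul_index, hP]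
    ring
  refine eq_add_one_of_modEq_of_dvd hpp.one_lt (card_sylow_modEq_one p G) ?_ (hm ▸ hindex)
  intro h1
  have : Subsingleton (Sylow p G) := (Nat.card_eq_one_iff_unique.1 h1).1
  have hnormal := P.normal_of_subsingleton
  have hp2 := hpp.two_le
  rcases hsimple.eq_bot_or_eq_top_of_normal P hnormal with h | h
  · rw [h, Subgroup.card_bot] at hP
    omega
  · rw [h, Subgroup.index_top] at hindex
    have := Nat.mul_le_mul (show 4 ≤ p + 1 by omega) (show 1 ≤ p - 1 by omega)
    omega

lemma exists_injective_isPSLLike_range (hsimple : IsSimpleGroup G)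
    (hcard : 2 * Nat.card G = p * (p + 1) * (p - 1)) (hp : p ≠ 2) :
    ∃ φ : G →* Perm (OnePoint (ZMod p)), Function.Injective φ ∧ IsPSLLike φ.range := by
  have hpp : p.Prime := Fact.out
  obtain ⟨P⟩ : Nonempty (Sylow p G) := inferInstance
  have hP (Q : Sylow p G) : Nat.card Q = p := card_sylow_eq_prime hcard hp Q
  have hS := card_sylow_eq_add_one hsimple hcard hp
  obtain ⟨Q, hQP⟩ : ∃ Q, Q ≠ P := by
    have : Nontrivial (Sylow p G) := by
      rw [← Finite.one_lt_card_iff_nontrivial, hS]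
      exact Nat.lt_add_of_pos_left hpp.pos
    exact exists_ne P
  let E : Multiplicative (ZMod p) ≃* P := mulEquivOfPrimeCardEq (p := p) (by simp) (hP P)
  let u (b : ZMod p) : G := E (.ofAdd b)
  have hu_add (a b : ZMod p) : u (a + b) = u a * u b := by simp [u]
  have huP (b : ZMod p) : u b • P = P :=
    Sylow.smul_eq_iff_mem_normalizer.2 (Subgroup.le_normalizer (E _).2)
  have hstab : MulAction.stabilizer P Q = ⊥ := by
    have : Fact (Nat.card P).Prime := ⟨by rwa [hP]⟩
    refine (Subgroup.eq_bot_or_eq_top_of_prime_card _).resolve_right fun htop => hQP ?_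
    have hle : (P : Subgroup G) ≤ Q := by
      refine (IsPGroup.sylow_mem_fixedPoints_iff P.isPGroup').1 fun x => ?_
      exact MulAction.mem_stabilizer_iff.1 (htop ▸ Subgroup.mem_top x)
    exact Sylow.ext (Subgroup.eq_of_le_of_card_ge hle (by rw [hP P, hP Q])).symm
  let e₀ : OnePoint (ZMod p) → Sylow p G := fun x => x.elim P fun b => u b • Q
  have he₀ : Function.Injective e₀ := by
    have hne (b : ZMod p) : u b • Q ≠ P := fun h => hQP
      (smul_left_cancel (u b) (h.trans (huP b).symm))
    intro x y hxy
    cases x with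
    | infty => cases y with
      | infty => rfl
      | coe y => exact absurd hxy.symm (hne y)
    | coe x => cases y with
      | infty => exact absurd hxy (hne x)
      | coe y =>
        replace hxy : u x • Q = u y • Q := hxy
        have hmem : E (.ofAdd (-y + x)) ∈ MulAction.stabilizer P Q := by
          rw [MulAction.mem_stabilizer_iff]
          change u (-y + x) • Q = Q
          rw [hu_add, mul_smul, hxy, ← mul_smul, ← hu_add]
          simp [u]
        rw [hstab, Subgroup.mem_bot, EmbeddingLike.map_eq_one_iff, ofAdd_eq_one,
          neg_add_eq_zero] at hmem
        rw [hmem]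
  have : Finite (OnePoint (ZMod p)) := inferInstanceAs (Finite (Option (ZMod p)))
  have hbij : Function.Bijective e₀ := he₀.bijective_of_nat_card_le <| by
    rw [hS, show Nat.card (OnePoint (ZMod p)) = Nat.card (Option (ZMod p)) from rfl,
      Finite.card_option, Nat.card_zmod]
  let e := Equiv.ofBijective e₀ hbij
  let φ : G →* Perm (OnePoint (ZMod p)) :=
    e.symm.permCongrHom.toMonoidHom.comp (MulAction.toPermHom G (Sylow p G))
  have hφ (g : G) (x : OnePoint (ZMod p)) : e (φ g x) = g • e x := by simp [φ]
  have hφu (b : ZMod p) : φ (u b) = affinePerm 1 b := by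
    ext x
    apply e.injective
    rw [hφ]
    cases x with
    | infty => exact huP b
    | coe x =>
      change u b • u x • Q = u (((1 : (ZMod p)ˣ) : ZMod p) * x + b) • Q
      rw [← mul_smul, ← hu_add, Units.val_one, one_mul, add_comm]
  have hinj : Function.Injective φ := by
    rw [← MonoidHom.ker_eq_bot_iff]
    refine (hsimple.eq_bot_or_eq_top_of_normal φ.ker inferInstance).resolve_right fun htop => ?_
    have h1 : φ (u 1) = 1 := MonoidHom.mem_ker.1 (htop ▸ Subgroup.mem_top _)
    rw [hφu] at h1
    simpa using congr($h1 ((0 : ZMod p) : OnePoint (ZMod p)))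
  have hΓ : G ≃* φ.range := MonoidHom.ofInjective hinj
  refine ⟨φ, hinj, isPSLLike_of_isSimpleGroup hp (hΓ.symm.isSimpleGroup) (fun b => ⟨_, hφu b⟩) ?_
    (by rw [← Nat.card_congr hΓ.toEquiv, hcard]) ?_⟩
  · rintro - ⟨g, rfl⟩ hgi
    have hgP : g • P = P := by
      have := hφ g ∞
      rw [hgi] at this
      exact this.symm
    have hconj : g * u 1 * g⁻¹ ∈ P :=
      (Subgroup.mem_normalizer_iff.1 (Sylow.smul_eq_iff_mem_normalizer.1 hgP) _).1 (E _).2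
    obtain ⟨c, hc⟩ := E.surjective ⟨_, hconj⟩
    refine exists_eq_affinePerm_of_mul_translation hgi (c := c.toAdd) ?_
    rw [← hφu, ← hφu, ← map_mul, ← map_mul]
    congr 1
    have : u c.toAdd = g * u 1 * g⁻¹ := congr(($hc).1)
    rw [this, inv_mul_cancel_right]
  · obtain ⟨g, hg⟩ := MulAction.exists_smul_eq G P Q
    refine ⟨_, ⟨g, rfl⟩, fun hgi => hQP ?_⟩
    have := hφ g ∞
    rw [hgi] at this
    exact hg.symm.trans this.symm

end sylow

theorem simple_group_of_order_psl2
    (p : ℕ) (hp : p.Prime) (hp3 : 3 < p)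
    (G : Type*) [Group G] [Finite G] (hsimple : IsSimpleGroup G)
    (hcard : Nat.card G = (p ^ 3 - p) / 2) :
    Nonempty (G ≃* (Matrix.SpecialLinearGroup (Fin 2) (ZMod p) ⧸
      Subgroup.center (Matrix.SpecialLinearGroup (Fin 2) (ZMod p)))) := by
  have : Fact p.Prime := ⟨hp⟩
  have hp2 : p ≠ 2 := by omega
  have hcard' : 2 * Nat.card G = p * (p + 1) * (p - 1) := by
    have h1 : p ^ 3 - p = p * (p + 1) * (p - 1) := by
      obtain ⟨q, rfl⟩ : ∃ q, p = q + 1 := ⟨p - 1, by omega⟩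
      rw [Nat.add_sub_cancel, Nat.sub_eq_iff_eq_add (Nat.le_self_pow (by omega) _)]
      ring
    rw [hcard, h1]
    refine Nat.mul_div_cancel' ((even_iff_two_dvd.1 ?_).mul_right _)
    exact Nat.even_mul_succ_self p
  obtain ⟨φ, hφ, hpsl⟩ := exists_injective_isPSLLike_range hsimple hcard' hp2
  exact ⟨(MonoidHom.ofInjective hφ).trans ((MulEquiv.subgroupCongr (hpsl.eq_range hp2)).trans
    ((QuotientGroup.quotientKerEquivRange _).symm.trans
      (QuotientGroup.quotientMulEquivOfEq ker_specialLinearPermHom)))⟩
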